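/- Let α, β > 0 with αβ = 4π², and let n be a complex number with Re n > 2. Then Σ_{j=1}^∞ (j − 1/2)^{n−1}/(e^{β(j−1/2)} + 1) + Γ(n)(2^{1−n} − 1) ζ(n)/β^n = cos(πn/2) ( (α/β)^{n/2} Σ_{j=1}^∞ (j − 1/2)^{n−1}/(e^{α(j−1/2)} + 1) + Γ(n)(2^{1−n} − 1) ζ(n)/(2π)^n ) − sin(πn/2) · P.V. ∫_0^∞ (z^{n−1}/(e^{2πz} + 1)) tan(βz/2) dz. -/

import Mathlib

open MeasureTheory Filter Set
open scoped Real Topology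

theorem integrableOn_rpow_mul_exp_neg_mul {s b : ℝ} (hs : -1 < s) (hb : 0 < b) :
    IntegrableOn (fun x : ℝ => x ^ s * Real.exp (-(b * x))) (Ioi 0) := by
  simpa using integrableOn_rpow_mul_exp_neg_mul_rpow hs one_pos hb

theorem norm_cpow_mul_exp_neg_mul (a r : ℂ) {t : ℝ} (ht : 0 < t) :
    ‖(t : ℂ) ^ a * Complex.exp (-(r * t))‖ = t ^ a.re * Real.exp (-(r.re * t)) := by
  rw [norm_mul, Complex.norm_cpow_eq_rpow_re_of_pos ht, Complex.norm_exp]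
  simp

theorem integrableOn_cpow_mul_exp_neg_mul {a r : ℂ} (ha : -1 < a.re) (hr : 0 < r.re) :
    IntegrableOn (fun t : ℝ => (t : ℂ) ^ a * Complex.exp (-(r * t))) (Ioi 0) :=
  Integrable.mono' (integrableOn_rpow_mul_exp_neg_mul ha hr)
    (Measurable.aestronglyMeasurable (by fun_prop))
    (ae_restrict_of_forall_mem measurableSet_Ioi fun _ ht =>
      (norm_cpow_mul_exp_neg_mul a r ht).le)

theorem differentiableOn_integral_cpow_mul_exp_neg_mul {a : ℂ} (ha : 0 < a.re) :
    DifferentiableOn ℂ (fun r : ℂ => ∫ t : ℝ in Ioi 0, (t : ℂ) ^ (a - 1) * Complex.exp (-(r * t)))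
      {r | 0 < r.re} := by
  intro r₀ hr₀
  have hr₀ : 0 < r₀.re := hr₀
  have hs : {r : ℂ | r₀.re / 2 < r.re} ∈ 𝓝 r₀ :=
    (isOpen_lt continuous_const Complex.continuous_re).mem_nhds (by simpa using half_lt_self hr₀)
  refine (hasDerivAt_integral_of_dominated_loc_of_deriv_le
    (F' := fun (r : ℂ) (t : ℝ) => -((t : ℂ) ^ a * Complex.exp (-(r * t))))
    (bound := fun t => t ^ a.re * Real.exp (-(r₀.re / 2 * t))) hs ?_ ?_ ?_ ?_
    (integrableOn_rpow_mul_exp_neg_mul (by linarith) (by linarith))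
    ?_).2.differentiableAt.differentiableWithinAt
  · exact Eventually.of_forall fun r => Measurable.aestronglyMeasurable (by fun_prop)
  · exact integrableOn_cpow_mul_exp_neg_mul (by simpa using ha) hr₀
  · exact Measurable.aestronglyMeasurable (by fun_prop)
  · refine ae_restrict_of_forall_mem measurableSet_Ioi fun t ht r hr => ?_
    have ht : 0 < t := ht
    have hr : r₀.re / 2 < r.re := hr
    rw [norm_neg, norm_cpow_mul_exp_neg_mul a r ht]
    gcongr
  · refine ae_restrict_of_forall_mem measurableSet_Ioi fun t ht r _ => ?_
    have ht : 0 < t := ht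
    have h1 : HasDerivAt (fun r : ℂ => -(r * t)) (-(1 * (t : ℂ))) r :=
      ((hasDerivAt_id r).mul_const (t : ℂ)).neg
    have h2 := h1.cexp.const_mul ((t : ℂ) ^ (a - 1))
    have : (t : ℂ) ^ a = (t : ℂ) ^ (a - 1) * t := by
      rw [Complex.cpow_sub _ _ (by exact_mod_cast ht.ne'), Complex.cpow_one,
        div_mul_cancel₀ _ (by exact_mod_cast ht.ne')]
    rwa [show (t : ℂ) ^ (a - 1) * (Complex.exp (-(r * t)) * -(1 * (t : ℂ))) =
      -((t : ℂ) ^ a * Complex.exp (-(r * t))) by rw [this]; ring] at h2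

/-- The Gamma integral with a complex rate in the right half-plane. -/
theorem integral_cpow_mul_exp_neg_complex_mul_Ioi {a r : ℂ} (ha : 0 < a.re) (hr : 0 < r.re) :
    ∫ t : ℝ in Ioi 0, (t : ℂ) ^ (a - 1) * Complex.exp (-(r * t)) =
      (1 / r) ^ a * Complex.Gamma a := by
  have hopen : IsOpen {r : ℂ | 0 < r.re} := isOpen_lt continuous_const Complex.continuous_re
  have hne : ∀ z : ℂ, 0 < z.re → z ≠ 0 := fun z hz h => by simp [h] at hz
  have hg : DifferentiableOn ℂ (fun r : ℂ => (1 / r) ^ a * Complex.Gamma a) {r | 0 < r.re} := by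
    intro z hz
    have hz : 0 < z.re := hz
    have h1 : DifferentiableAt ℂ (fun r : ℂ => 1 / r) z :=
      (differentiableAt_const _).div differentiableAt_id (hne z hz)
    refine ((h1.cpow_const ?_).mul_const _).differentiableWithinAt
    left
    rw [one_div, Complex.inv_re]
    exact div_pos hz (Complex.normSq_pos.2 (hne z hz))
  have hconn : IsPreconnected {r : ℂ | 0 < r.re} :=
    (convex_halfSpace_re_gt 0).isPreconnected
  refine ((differentiableOn_integral_cpow_mul_exp_neg_mul ha).analyticOnNhd
    hopen).eqOn_of_preconnected_of_frequently_eq (hg.analyticOnNhd hopen) hconn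
    (z₀ := 1) (by simp) ?_ hr
  have htend : Tendsto (fun x : ℝ => (x : ℂ)) (𝓝[>] 1) (𝓝[≠] 1) := by
    refine tendsto_nhdsWithin_of_tendsto_nhds_of_eventually_within _
      (tendsto_nhdsWithin_of_tendsto_nhds (by simpa using Complex.continuous_ofReal.tendsto 1)) ?_
    filter_upwards [self_mem_nhdsWithin] with x hx
    have hx : 1 < x := hx
    simpa using hx.ne'
  refine htend.frequently (Eventually.frequently ?_)
  filter_upwards [self_mem_nhdsWithin] with x hx
  exact Complex.integral_cpow_mul_exp_neg_mul_Ioi ha (zero_lt_one.trans hx)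

/-- On one period, the integral of a function against a weight that is periodic and odd about the
centre of the period is the integral of the antisymmetrised function over half a period. -/
theorem setIntegral_Ioc_period_eq_of_odd {F : ℝ → ℂ} {W : ℝ → ℝ} {L : ℝ} (hL : 0 < L) (m : ℕ)
    (hint : IntegrableOn (fun x => F x * W x) (Ioi 0))
    (hper : Function.Periodic W L) (hodd : ∀ u, W (L / 2 - u) = -W (L / 2 + u)) :
    ∫ x in Ioc (m * L) ((m + 1) * L), F x * W x =
      ∫ u in Ioo 0 (L / 2),
        (F ((m + 1 / 2) * L + u) - F ((m + 1 / 2) * L - u)) * W (L / 2 + u) := by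
  have hm : 0 ≤ (m : ℝ) * L := by positivity
  have hsub : ∀ a b : ℝ, 0 ≤ a → a ≤ b → IntervalIntegrable (fun x => F x * W x) volume a b :=
    fun a b ha hab => (intervalIntegrable_iff_integrableOn_Ioc_of_le hab).2
      (hint.mono_set fun x hx => ha.trans_lt hx.1)
  have hWp : ∀ u, W ((m + 1 / 2) * L + u) = W (L / 2 + u) := fun u => by
    have := hper.nat_mul m (L / 2 + u)
    rw [← this]; ring_nf
  have hWm : ∀ u, W ((m + 1 / 2) * L - u) = -W (L / 2 + u) := fun u => by
    rw [sub_eq_add_neg, hWp, ← hodd]; ring_nf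
  have i1 := hsub (m * L) ((m + 1 / 2) * L) hm (by nlinarith)
  have i2 := hsub ((m + 1 / 2) * L) ((m + 1) * L) (by nlinarith) (by nlinarith)
  have e1 := intervalIntegral.integral_comp_sub_left (fun x => F x * W x) (a := 0) (b := L / 2)
    ((m + 1 / 2) * L)
  have e2 := intervalIntegral.integral_comp_add_left (fun x => F x * W x) (a := 0) (b := L / 2)
    ((m + 1 / 2) * L)
  have j1 := i1.comp_sub_left ((m + 1 / 2) * L)
  have j2 := i2.comp_add_left ((m + 1 / 2) * L)
  rw [show (m + 1 / 2) * L - L / 2 = m * L by ring, sub_zero] at e1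
  rw [show (m + 1 / 2) * L + L / 2 = (m + 1) * L by ring, add_zero] at e2
  rw [show (m + 1 / 2) * L - m * L = L / 2 by ring, sub_self] at j1
  rw [show (m + 1) * L - (m + 1 / 2) * L = L / 2 by ring, sub_self] at j2
  rw [← intervalIntegral.integral_of_le (by nlinarith),
    ← intervalIntegral.integral_add_adjacent_intervals i1 i2, ← e1, ← e2,
    ← intervalIntegral.integral_add j1.symm j2, intervalIntegral.integral_of_le (by positivity),
    integral_Ioc_eq_integral_Ioo]
  refine integral_congr_ae (Eventually.of_forall fun u => ?_)
  simp only [hWp, hWm]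
  push_cast
  ring

/-- Dominated convergence after folding: if periodic odd weights `W i` with singularities of order
at most one at the centres `(m + 1/2) L` converge pointwise, then the integrals `∫ F W i` converge
to a folded integral depending only on the limit weight. -/
theorem tendsto_integral_periodic_odd_weight {ι : Type*} {l : Filter ι} [l.IsCountablyGenerated]
    {F : ℝ → ℂ} {W : ι → ℝ → ℝ} {M : ℕ → ℝ} {ω : ℝ → ℝ} {L c : ℝ} (hL : 0 < L)
    (hF : IntegrableOn F (Ioi 0)) (hFm : Measurable F) (hM : Summable M)
    (hFM : ∀ m : ℕ, ∀ u ∈ Ioo 0 (L / 2),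
      ‖F ((m + 1 / 2) * L + u) - F ((m + 1 / 2) * L - u)‖ ≤ M m * u)
    (hper : ∀ i, Function.Periodic (W i) L) (hodd : ∀ i u, W i (L / 2 - u) = -W i (L / 2 + u))
    (hWm : ∀ i, Measurable (W i)) (hWb : ∀ᶠ i in l, ∃ B, ∀ x, |W i x| ≤ B)
    (hWc : ∀ i, ∀ u ∈ Ioo 0 (L / 2), |W i (L / 2 + u)| ≤ c / u)
    (hlim : ∀ u ∈ Ioo 0 (L / 2), Tendsto (fun i => W i (L / 2 + u)) l (𝓝 (ω u))) :
    Tendsto (fun i => ∫ x in Ioi 0, F x * W i x) l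
      (𝓝 (∑' m : ℕ, ∫ u in Ioo 0 (L / 2),
        (F ((m + 1 / 2) * L + u) - F ((m + 1 / 2) * L - u)) * ω u)) := by
  have hbound : ∀ i (m : ℕ), ∀ u ∈ Ioo 0 (L / 2),
      ‖(F ((m + 1 / 2) * L + u) - F ((m + 1 / 2) * L - u)) * (W i (L / 2 + u) : ℂ)‖
        ≤ M m * c := by
    intro i m u hu
    have hu0 : 0 < u := hu.1
    rw [norm_mul, Complex.norm_real, Real.norm_eq_abs]
    calc _ ≤ M m * u * (c / u) :=
          mul_le_mul (hFM m u hu) (hWc i u hu) (abs_nonneg _) ((norm_nonneg _).trans (hFM m u hu))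
      _ = M m * c := by field_simp
  have hmeas : ∀ i (m : ℕ), Measurable fun u : ℝ =>
      (F ((m + 1 / 2) * L + u) - F ((m + 1 / 2) * L - u)) * (W i (L / 2 + u) : ℂ) := by
    intro i m
    have := hWm i
    fun_prop
  have hsum : ∀ᶠ i in l, ∫ x in Ioi 0, F x * W i x = ∑' m : ℕ, ∫ u in Ioo 0 (L / 2),
      (F ((m + 1 / 2) * L + u) - F ((m + 1 / 2) * L - u)) * (W i (L / 2 + u) : ℂ) := by
    filter_upwards [hWb] with i ⟨B, hB⟩
    have hint : IntegrableOn (fun x => F x * W i x) (Ioi 0) := by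
      refine Integrable.mul_bdd hF (c := B)
        ((hWm i).complex_ofReal.aestronglyMeasurable) (Eventually.of_forall fun x => ?_)
      rw [Complex.norm_real]
      exact hB x
    have hU : ⋃ m : ℕ, Ioc ((m : ℝ) * L) ((m + 1) * L) = Ioi 0 := by
      ext x
      simp only [mem_iUnion, mem_Ioc, mem_Ioi]
      constructor
      · rintro ⟨m, h, -⟩
        exact lt_of_le_of_lt (by positivity) h
      · intro hx
        have h1 : 0 < ⌈x / L⌉₊ := Nat.ceil_pos.2 (by positivity)
        obtain ⟨k, hk⟩ := Nat.exists_eq_succ_of_ne_zero h1.ne'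
        have h2 := Nat.le_ceil (x / L)
        have h3 := Nat.ceil_lt_add_one (div_nonneg hx.le hL.le)
        rw [hk] at h2 h3
        push_cast at h2 h3
        exact ⟨k, (lt_div_iff₀ hL).1 (by linarith), (div_le_iff₀ hL).1 h2⟩
    have hd : Pairwise (Function.onFun Disjoint fun m : ℕ => Ioc ((m : ℝ) * L) ((m + 1) * L)) := by
      have : Monotone fun m : ℕ => (m : ℝ) * L := fun a b h =>
        mul_le_mul_of_nonneg_right (by exact_mod_cast h) hL.le
      have := this.pairwise_disjoint_on_Ioc_succ
      simpa using this
    have := hasSum_integral_iUnion (fun m => measurableSet_Ioc) hd (by rw [hU]; exact hint)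
    rw [hU] at this
    rw [← this.tsum_eq]
    exact tsum_congr fun m => setIntegral_Ioc_period_eq_of_odd hL m hint (hper i) (hodd i)
  refine Tendsto.congr' (hsum.mono fun i hi => hi.symm) ?_
  have hfin : volume (Ioo 0 (L / 2)) < ⊤ := by simp
  refine tendsto_tsum_of_dominated_convergence (bound := fun m => M m * c * (L / 2))
    ((hM.mul_right c).mul_right _) (fun m => ?_) (Eventually.of_forall fun i m => ?_)
  · refine tendsto_integral_filter_of_dominated_convergence (fun _ => M m * c)
      (Eventually.of_forall fun i => (hmeas i m).aestronglyMeasurable)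
      (Eventually.of_forall fun i => ae_restrict_of_forall_mem measurableSet_Ioo (hbound i m))
      (integrableOn_const hfin.ne) (ae_restrict_of_forall_mem measurableSet_Ioo fun u hu => ?_)
    exact tendsto_const_nhds.mul ((Complex.continuous_ofReal.tendsto _).comp (hlim u hu))
  · have := norm_setIntegral_le_of_norm_le_const hfin (hbound i m)
    rwa [Real.volume_real_Ioo_of_le (by positivity), sub_zero] at this
/-- Smooth periodic approximation of `tan (β x / 2)`, recovered as `δ → 0`. -/
noncomputable def regularizedTan (β δ x : ℝ) : ℝ :=
  Real.sin (β * x) / (Real.cosh δ + Real.cos (β * x))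

open Classical in
/-- `tan (β x / 2)` with the `ε`-neighbourhoods of all its (real) poles removed. -/
noncomputable def truncatedTan (β ε x : ℝ) : ℝ :=
  if ∀ m : ℤ, ε ≤ |x - (2 * (m : ℝ) - 1) * π / β| then Real.tan (β * x / 2) else 0

theorem abs_cos_div_sin_le {t : ℝ} (h0 : t ≠ 0) (ht : |t| ≤ π / 2) :
    |Real.cos t / Real.sin t| ≤ π / 2 / |t| := by
  have h := Real.mul_abs_le_abs_sin ht
  have ht0 : 0 < |t| := abs_pos.2 h0
  have hp : 0 < 2 / π * |t| := by positivity
  rw [abs_div, div_le_div_iff₀ (hp.trans_le h) ht0]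
  have h2 : |t| ≤ π / 2 * |Real.sin t| := by
    calc |t| = π / 2 * (2 / π * |t|) := by field_simp
      _ ≤ _ := by gcongr
  nlinarith [Real.abs_cos_le_one t, abs_nonneg (Real.cos t)]

theorem tan_pi_div_two_add (t : ℝ) : Real.tan (π / 2 + t) = -(Real.cos t / Real.sin t) := by
  rw [Real.tan_eq_sin_div_cos, Real.sin_add, Real.cos_add]
  simp [div_neg]

section weights

variable {β : ℝ}

theorem regularizedTan_periodic (hβ : 0 < β) (δ : ℝ) :
    Function.Periodic (regularizedTan β δ) (2 * π / β) := by
  intro x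
  have : β * (x + 2 * π / β) = β * x + 2 * π := by field_simp
  simp [regularizedTan, this]

theorem regularizedTan_half_add (hβ : 0 < β) (δ u : ℝ) :
    regularizedTan β δ (2 * π / β / 2 + u) =
      -(Real.sin (β * u) / (Real.cosh δ - Real.cos (β * u))) := by
  have : β * (2 * π / β / 2 + u) = β * u + π := by field_simp; ring
  simp [regularizedTan, this, neg_div, sub_eq_add_neg]

theorem regularizedTan_half_sub (hβ : 0 < β) (δ u : ℝ) :
    regularizedTan β δ (2 * π / β / 2 - u) = -regularizedTan β δ (2 * π / β / 2 + u) := by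
  rw [sub_eq_add_neg, regularizedTan_half_add hβ, regularizedTan_half_add hβ]
  simp [neg_div]

theorem measurable_regularizedTan (δ : ℝ) : Measurable (regularizedTan β δ) := by
  unfold regularizedTan
  fun_prop

theorem abs_regularizedTan_le {δ : ℝ} (hδ : δ ≠ 0) (x : ℝ) :
    |regularizedTan β δ x| ≤ 1 / (Real.cosh δ - 1) := by
  have h1 := Real.one_lt_cosh.2 hδ
  have h2 := Real.neg_one_le_cos (β * x)
  rw [regularizedTan, abs_div, abs_of_pos (a := _ + _) (by linarith)]
  exact div_le_div₀ zero_le_one (Real.abs_sin_le_one _) (by linarith) (by linarith)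

theorem sin_div_one_sub_cos (y : ℝ) :
    Real.sin y / (1 - Real.cos y) = Real.cos (y / 2) / Real.sin (y / 2) := by
  obtain ⟨t, rfl⟩ : ∃ t, y = 2 * t := ⟨y / 2, by ring⟩
  rw [show 2 * t / 2 = t by ring, Real.sin_two_mul, Real.cos_two_mul, Real.cos_sq']
  rcases eq_or_ne (Real.sin t) 0 with h | h
  · simp [h]
  · rw [show 1 - (2 * (1 - Real.sin t ^ 2) - 1) = 2 * Real.sin t * Real.sin t by ring,
      mul_div_mul_left _ _ (by positivity)]

theorem half_mem {u : ℝ} (hβ : 0 < β) (hu : u ∈ Ioo 0 (2 * π / β / 2)) :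
    0 < β * u / 2 ∧ β * u / 2 < π / 2 := by
  have h1 := hu.1
  have h2 := hu.2
  refine ⟨by positivity, ?_⟩
  rw [div_div, lt_div_iff₀ (by positivity)] at h2
  linarith

theorem abs_regularizedTan_half_add_le (hβ : 0 < β) (δ : ℝ) {u : ℝ}
    (hu : u ∈ Ioo 0 (2 * π / β / 2)) :
    |regularizedTan β δ (2 * π / β / 2 + u)| ≤ π / β / u := by
  obtain ⟨h1, h2⟩ := half_mem hβ hu
  have hu0 : 0 < u := hu.1
  have hs : 0 < Real.sin (β * u) := Real.sin_pos_of_pos_of_lt_pi (by linarith) (by linarith)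
  have hc : Real.cos (β * u) < 1 := by
    nlinarith [Real.sin_sq_add_cos_sq (β * u), Real.neg_one_le_cos (β * u)]
  have hd := Real.one_le_cosh δ
  rw [regularizedTan_half_add hβ, abs_neg,
    abs_of_nonneg (div_nonneg hs.le (by linarith))]
  calc _ ≤ Real.sin (β * u) / (1 - Real.cos (β * u)) :=
        div_le_div_of_nonneg_left hs.le (by linarith) (by linarith)
    _ = Real.cos (β * u / 2) / Real.sin (β * u / 2) := sin_div_one_sub_cos _
    _ ≤ _ := (le_abs_self _).trans (abs_cos_div_sin_le h1.ne' (by rw [abs_of_pos h1]; exact h2.le))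
    _ = π / β / u := by rw [abs_of_pos h1]; field_simp

theorem tendsto_regularizedTan_half_add (hβ : 0 < β) {u : ℝ} (hu : u ∈ Ioo 0 (2 * π / β / 2)) :
    Tendsto (fun δ => regularizedTan β δ (2 * π / β / 2 + u)) (𝓝[>] 0)
      (𝓝 (-(Real.cos (β * u / 2) / Real.sin (β * u / 2)))) := by
  obtain ⟨h1, h2⟩ := half_mem hβ hu
  have hs : 0 < Real.sin (β * u) := Real.sin_pos_of_pos_of_lt_pi (by linarith) (by linarith)
  have hc : Real.cos (β * u) < 1 := by
    nlinarith [Real.sin_sq_add_cos_sq (β * u), Real.neg_one_le_cos (β * u)]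
  simp only [regularizedTan_half_add hβ, ← sin_div_one_sub_cos]
  refine tendsto_nhdsWithin_of_tendsto_nhds (Tendsto.neg (Tendsto.div tendsto_const_nhds ?_
    (by linarith)))
  have := (Real.continuous_cosh.tendsto 0).sub_const (Real.cos (β * u))
  rwa [Real.cosh_zero] at this

theorem truncatedTan_periodic (hβ : 0 < β) (ε : ℝ) :
    Function.Periodic (truncatedTan β ε) (2 * π / β) := by
  intro x
  have h1 : β * (x + 2 * π / β) / 2 = β * x / 2 + π := by field_simp
  have h2 : (∀ m : ℤ, ε ≤ |x + 2 * π / β - (2 * (m : ℝ) - 1) * π / β|) ↔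
      ∀ m : ℤ, ε ≤ |x - (2 * (m : ℝ) - 1) * π / β| := by
    constructor
    · intro h m
      convert h (m + 1) using 2
      push_cast; ring
    · intro h m
      convert h (m - 1) using 2
      push_cast; ring
  rw [truncatedTan, truncatedTan, h1, Real.tan_periodic]
  classical exact if_congr h2 rfl rfl

theorem truncatedTan_half_sub (hβ : 0 < β) (ε u : ℝ) :
    truncatedTan β ε (2 * π / β / 2 - u) = -truncatedTan β ε (2 * π / β / 2 + u) := by
  have h1 : β * (2 * π / β / 2 - u) / 2 = π / 2 + -(β * u / 2) := by field_simp; ring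
  have h1' : β * (2 * π / β / 2 + u) / 2 = π / 2 + β * u / 2 := by field_simp
  have h2 : (∀ m : ℤ, ε ≤ |2 * π / β / 2 - u - (2 * (m : ℝ) - 1) * π / β|) ↔
      ∀ m : ℤ, ε ≤ |2 * π / β / 2 + u - (2 * (m : ℝ) - 1) * π / β| := by
    constructor
    · intro h m
      convert h (2 - m) using 1
      rw [← abs_neg]
      congr 1
      push_cast; ring
    · intro h m
      convert h (2 - m) using 1
      rw [← abs_neg]
      congr 1
      push_cast; ring
  rw [truncatedTan, truncatedTan, h1, h1', tan_pi_div_two_add, tan_pi_div_two_add, Real.cos_neg,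
    Real.sin_neg, div_neg, neg_neg]
  by_cases h : ∀ m : ℤ, ε ≤ |2 * π / β / 2 + u - (2 * (m : ℝ) - 1) * π / β|
  · rw [if_pos h, if_pos (h2.2 h), neg_neg]
  · rw [if_neg h, if_neg (mt h2.1 h), neg_zero]

theorem measurable_truncatedTan (ε : ℝ) : Measurable (truncatedTan β ε) := by
  have h : MeasurableSet {x : ℝ | ∀ m : ℤ, ε ≤ |x - (2 * (m : ℝ) - 1) * π / β|} := by
    rw [ofPred_forall]
    exact MeasurableSet.iInter fun m => measurableSet_le measurable_const (by fun_prop)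
  refine Measurable.ite h ?_ measurable_const
  simp only [Real.tan_eq_sin_div_cos]
  fun_prop

theorem abs_truncatedTan_le (hβ : 0 < β) {ε : ℝ} (hε : 0 < ε) (x : ℝ) :
    |truncatedTan β ε x| ≤ π / β / ε := by
  unfold truncatedTan
  split_ifs with h
  · set k : ℤ := round ((x - π / β) / (2 * π / β)) with hk
    set v : ℝ := x - π / β - k * (2 * π / β) with hv
    have hv1 : |v| ≤ π / β := by
      have := abs_sub_round ((x - π / β) / (2 * π / β))
      rw [← hk] at this
      have e : v = ((x - π / β) / (2 * π / β) - k) * (2 * π / β) := by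
        rw [hv]; field_simp
      rw [e, abs_mul, abs_of_pos (a := 2 * π / β) (by positivity)]
      calc _ ≤ 1 / 2 * (2 * π / β) := by gcongr
        _ = π / β := by ring
    have hv2 : ε ≤ |v| := by
      convert h (k + 1) using 2
      rw [hv]; push_cast; ring
    have hv0 : v ≠ 0 := by
      rintro h0
      rw [h0, abs_zero] at hv2
      linarith
    have e : β * x / 2 = π / 2 + β * v / 2 + k * π := by
      rw [hv]; field_simp; ring
    have hab : |β * v / 2| = β * |v| / 2 := by
      rw [abs_div, abs_mul, abs_of_pos hβ, abs_two]
    rw [e, Real.tan_add_int_mul_pi, tan_pi_div_two_add, abs_neg]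
    calc _ ≤ π / 2 / |β * v / 2| := by
          refine abs_cos_div_sin_le (by positivity) ?_
          rw [hab]
          rw [le_div_iff₀ hβ] at hv1
          linarith
      _ = π / β / |v| := by rw [hab]; have := abs_pos.2 hv0; field_simp
      _ ≤ π / β / ε := by gcongr
  · simp; positivity

theorem abs_truncatedTan_half_add_le (hβ : 0 < β) (ε : ℝ) {u : ℝ}
    (hu : u ∈ Ioo 0 (2 * π / β / 2)) :
    |truncatedTan β ε (2 * π / β / 2 + u)| ≤ π / β / u := by
  obtain ⟨h1, h2⟩ := half_mem hβ hu
  have hu0 : 0 < u := hu.1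
  have h1' : β * (2 * π / β / 2 + u) / 2 = π / 2 + β * u / 2 := by field_simp
  unfold truncatedTan
  split_ifs
  · rw [h1', tan_pi_div_two_add, abs_neg]
    refine (abs_cos_div_sin_le h1.ne' (by rw [abs_of_pos h1]; exact h2.le)).trans_eq ?_
    rw [abs_of_pos h1]; field_simp
  · rw [abs_zero]; positivity

theorem tendsto_truncatedTan_half_add (hβ : 0 < β) {u : ℝ} (hu : u ∈ Ioo 0 (2 * π / β / 2)) :
    Tendsto (fun ε => truncatedTan β ε (2 * π / β / 2 + u)) (𝓝[>] 0)
      (𝓝 (-(Real.cos (β * u / 2) / Real.sin (β * u / 2)))) := by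
  refine tendsto_const_nhds.congr' ?_
  filter_upwards [Ioo_mem_nhdsGT hu.1] with ε hε
  have h1' : β * (2 * π / β / 2 + u) / 2 = π / 2 + β * u / 2 := by field_simp
  rw [truncatedTan, if_pos, h1', tan_pi_div_two_add]
  intro m
  have hL : 0 < 2 * π / β := by positivity
  have e : 2 * π / β / 2 + u - (2 * (m : ℝ) - 1) * π / β = u - (m - 1) * (2 * π / β) := by
    ring
  rw [e]
  refine hε.2.le.trans ?_
  rcases le_or_gt m 1 with hm | hm
  · have : (m : ℝ) - 1 ≤ 0 := by exact_mod_cast sub_nonpos.2 hm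
    refine le_trans ?_ (le_abs_self _)
    nlinarith
  · have : (1 : ℝ) ≤ m - 1 := by
      have : (2 : ℝ) ≤ m := by exact_mod_cast hm
      linarith
    refine le_trans ?_ (neg_le_abs _)
    have := hu.2
    nlinarith

end weights

/-- The weight `x ^ (n - 1) / (exp (2 π x) + 1)` of the principal value integral. -/
noncomputable def fermiWeight (n : ℂ) (x : ℝ) : ℂ :=
  (x : ℂ) ^ (n - 1) / (((Real.exp (2 * π * x) : ℝ) : ℂ) + 1)

theorem measurable_fermiWeight (n : ℂ) : Measurable (fermiWeight n) := by
  unfold fermiWeight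
  fun_prop

theorem norm_fermiWeight (n : ℂ) {x : ℝ} (hx : 0 < x) :
    ‖fermiWeight n x‖ = x ^ (n.re - 1) / (Real.exp (2 * π * x) + 1) := by
  have h : (((Real.exp (2 * π * x) : ℝ) : ℂ) + 1) = ((Real.exp (2 * π * x) + 1 : ℝ) : ℂ) := by
    push_cast; rfl
  rw [fermiWeight, norm_div, Complex.norm_cpow_eq_rpow_re_of_pos hx, h, Complex.norm_real,
    Real.norm_of_nonneg (by positivity)]
  simp

theorem integrableOn_fermiWeight {n : ℂ} (hn : 0 < n.re) :
    IntegrableOn (fermiWeight n) (Ioi 0) := by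
  refine Integrable.mono'
    (integrableOn_rpow_mul_exp_neg_mul (s := n.re - 1) (b := 2 * π) (by linarith) (by positivity))
    (measurable_fermiWeight n).aestronglyMeasurable
    (ae_restrict_of_forall_mem measurableSet_Ioi fun x hx => ?_)
  have hx : 0 < x := hx
  rw [norm_fermiWeight n hx, Real.exp_neg, div_eq_mul_inv]
  gcongr
  linarith

theorem rpow_le_mul_exp {a x : ℝ} (ha : 0 < a) (hx : 0 < x) :
    x ^ a ≤ a ^ a * Real.exp x := by
  have h1 : x / a ≤ Real.exp (x / a) := by linarith [Real.add_one_le_exp (x / a)]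
  calc x ^ a = (a * (x / a)) ^ a := by rw [mul_div_cancel₀ _ ha.ne']
    _ = a ^ a * (x / a) ^ a := Real.mul_rpow ha.le (by positivity)
    _ ≤ a ^ a * Real.exp (x / a) ^ a := by gcongr
    _ = a ^ a * Real.exp x := by rw [← Real.exp_mul, div_mul_cancel₀ _ ha.ne']

theorem rpow_div_exp_le {a x : ℝ} (ha : 0 < a) (hx : 0 < x) :
    x ^ a / (Real.exp (2 * π * x) + 1) ≤ a ^ a * Real.exp (-x) := by
  have hE : Real.exp (2 * x) ≤ Real.exp (2 * π * x) :=
    Real.exp_le_exp.2 (by nlinarith [Real.pi_gt_three])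
  rw [div_le_iff₀ (by positivity)]
  calc x ^ a ≤ a ^ a * Real.exp x := rpow_le_mul_exp ha hx
    _ = a ^ a * Real.exp (-x) * Real.exp (2 * x) := by
        rw [mul_assoc, ← Real.exp_add]; ring_nf
    _ ≤ _ := by gcongr; linarith

theorem exists_norm_fermiWeight_sub_le {n : ℂ} (hn : 2 < n.re) {L : ℝ} (hL : 0 < L) :
    ∃ M : ℕ → ℝ, Summable M ∧ ∀ m : ℕ, ∀ u ∈ Ioo 0 (L / 2),
      ‖fermiWeight n ((m + 1 / 2) * L + u) - fermiWeight n ((m + 1 / 2) * L - u)‖ ≤ M m * u := by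
  set K : ℝ := ‖n - 1‖ * (n.re - 2) ^ (n.re - 2) + 2 * π * (n.re - 1) ^ (n.re - 1) with hK
  have hK0 : 0 ≤ K := by
    have h1 : 0 ≤ (n.re - 2) ^ (n.re - 2) := Real.rpow_nonneg (by linarith) _
    have h2 : 0 ≤ (n.re - 1) ^ (n.re - 1) := Real.rpow_nonneg (by linarith) _
    positivity
  have hderiv : ∀ x : ℝ, 0 < x → ∃ d : ℂ, HasDerivAt (fermiWeight n) d x ∧
      ‖d‖ ≤ K * Real.exp (-x) := by
    intro x hx
    have hn1 : n - 1 ≠ 0 := fun h => by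
      have := congrArg Complex.re h
      simp at this
      linarith
    have h1 := hasDerivAt_ofReal_cpow_const (r := n - 1) hx.ne' hn1
    have h2 : HasDerivAt (fun y : ℝ => ((Real.exp (2 * π * y) : ℝ) : ℂ) + 1)
        ((Real.exp (2 * π * x) * (2 * π) : ℝ) : ℂ) x := by
      have := (((hasDerivAt_id x).const_mul (2 * π)).exp).ofReal_comp.add_const (1 : ℂ)
      simpa using this
    have hE : 0 < Real.exp (2 * π * x) := Real.exp_pos _
    have hcast : (((Real.exp (2 * π * x) : ℝ) : ℂ) + 1) =
        ((Real.exp (2 * π * x) + 1 : ℝ) : ℂ) := by push_cast; rfl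
    have hne : (((Real.exp (2 * π * x) : ℝ) : ℂ) + 1) ≠ 0 := by
      rw [hcast, Complex.ofReal_ne_zero]; positivity
    refine ⟨_, h1.div h2 hne, ?_⟩
    have hsplit : ((n - 1) * (x : ℂ) ^ (n - 1 - 1) * (((Real.exp (2 * π * x) : ℝ) : ℂ) + 1) -
        (x : ℂ) ^ (n - 1) * ((Real.exp (2 * π * x) * (2 * π) : ℝ) : ℂ)) /
          (((Real.exp (2 * π * x) : ℝ) : ℂ) + 1) ^ 2 =
        (n - 1) * ((x : ℂ) ^ (n - 1 - 1) / (((Real.exp (2 * π * x) : ℝ) : ℂ) + 1)) -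
        ((2 * π * (Real.exp (2 * π * x) / (Real.exp (2 * π * x) + 1)) : ℝ) : ℂ) *
          fermiWeight n x := by
      rw [fermiWeight]
      push_cast at hne ⊢
      field_simp
    rw [hsplit]
    have hf : Real.exp (2 * π * x) / (Real.exp (2 * π * x) + 1) ≤ 1 :=
      (div_le_one (by positivity)).2 (by linarith)
    have b1 : ‖(x : ℂ) ^ (n - 1 - 1) / (((Real.exp (2 * π * x) : ℝ) : ℂ) + 1)‖ ≤
        (n.re - 2) ^ (n.re - 2) * Real.exp (-x) := by
      have h : ‖fermiWeight (n - 1) x‖ = _ := norm_fermiWeight (n - 1) hx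
      rw [fermiWeight] at h
      rw [h]
      have e : (n - 1).re - 1 = n.re - 2 := by simp; ring
      rw [e]
      exact rpow_div_exp_le (by linarith) hx
    have b2 : ‖fermiWeight n x‖ ≤ (n.re - 1) ^ (n.re - 1) * Real.exp (-x) := by
      rw [norm_fermiWeight n hx]
      exact rpow_div_exp_le (by linarith) hx
    refine (norm_sub_le _ _).trans ?_
    rw [norm_mul, norm_mul, Complex.norm_real, Real.norm_of_nonneg (by positivity)]
    calc _ ≤ ‖n - 1‖ * ((n.re - 2) ^ (n.re - 2) * Real.exp (-x)) +
          2 * π * 1 * ((n.re - 1) ^ (n.re - 1) * Real.exp (-x)) := by gcongr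
      _ = K * Real.exp (-x) := by rw [hK]; ring
  choose! f' hf' hf'b using hderiv
  refine ⟨fun m => 2 * K * Real.exp (-L) ^ m, ?_, fun m u hu => ?_⟩
  · exact (summable_geometric_of_lt_one (Real.exp_pos _).le
      (by simpa using hL)).mul_left _
  · obtain ⟨hu0, hu1⟩ := hu
    have hpos : ∀ x ∈ Icc ((m + 1 / 2) * L - u) ((m + 1 / 2) * L + u), m * L < x := by
      intro x hx
      have := hx.1
      linarith
    have hm : 0 ≤ (m : ℝ) * L := by positivity
    have := (convex_Icc ((m + 1 / 2) * L - u) ((m + 1 / 2) * L + u)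
      ).norm_image_sub_le_of_norm_hasDerivWithin_le
      (f := fermiWeight n) (f' := f') (C := K * Real.exp (-L) ^ m)
      (fun x hx => (hf' x (hm.trans_lt (hpos x hx))).hasDerivWithinAt)
      (fun x hx => (hf'b x (hm.trans_lt (hpos x hx))).trans ?_)
      (left_mem_Icc.2 (by linarith)) (right_mem_Icc.2 (by linarith))
    · refine this.trans_eq ?_
      rw [show (m + 1 / 2) * L + u - ((m + 1 / 2) * L - u) = 2 * u by ring, Real.norm_of_nonneg
        (by linarith)]
      ring
    · rw [← Real.exp_nat_mul]
      gcongr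
      linarith [hpos x hx]

/-- The smoothly regularised integral and the truncated integral have a common limit. -/
theorem exists_tendsto_regularized_and_truncated {n : ℂ} (hn : 2 < n.re) {β : ℝ} (hβ : 0 < β) :
    ∃ S : ℂ, Tendsto (fun δ => ∫ x in Ioi 0, fermiWeight n x * regularizedTan β δ x)
        (𝓝[>] 0) (𝓝 S) ∧
      Tendsto (fun ε => ∫ x in Ioi 0, fermiWeight n x * truncatedTan β ε x) (𝓝[>] 0) (𝓝 S) := by
  have hL : 0 < 2 * π / β := by positivity
  obtain ⟨M, hM, hFM⟩ := exists_norm_fermiWeight_sub_le hn hL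
  have hF := integrableOn_fermiWeight (n := n) (by linarith)
  refine ⟨_, tendsto_integral_periodic_odd_weight hL hF (measurable_fermiWeight n) hM hFM
    (regularizedTan_periodic hβ) (regularizedTan_half_sub hβ) measurable_regularizedTan ?_
    (fun δ u hu => abs_regularizedTan_half_add_le hβ δ hu)
    (fun u hu => tendsto_regularizedTan_half_add hβ hu),
    tendsto_integral_periodic_odd_weight hL hF (measurable_fermiWeight n) hM hFM
    (truncatedTan_periodic hβ) (truncatedTan_half_sub hβ) measurable_truncatedTan ?_
    (fun δ u hu => abs_truncatedTan_half_add_le hβ δ hu)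
    (fun u hu => tendsto_truncatedTan_half_add hβ hu)⟩
  · filter_upwards [self_mem_nhdsWithin] with δ hδ
    exact ⟨_, abs_regularizedTan_le (ne_of_gt hδ)⟩
  · filter_upwards [self_mem_nhdsWithin] with ε hε
    exact ⟨_, abs_truncatedTan_le hβ hε⟩

theorem setIntegral_truncated_eq (n : ℂ) {β ε : ℝ} (hβ : 0 < β) (hε : ε ≤ π / β) :
    ∫ z in {z : ℝ | 0 < z ∧ ∀ m : ℕ, 1 ≤ m → ε ≤ |z - (2 * (m : ℝ) - 1) * π / β|},
        ((z : ℂ) ^ (n - 1) / (((Real.exp (2 * π * z) : ℝ) : ℂ) + 1)) *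
          ((Real.tan (β * z / 2) : ℝ) : ℂ) =
      ∫ x in Ioi 0, fermiWeight n x * truncatedTan β ε x := by
  classical
  set s : Set ℝ := {z : ℝ | ∀ m : ℕ, 1 ≤ m → ε ≤ |z - (2 * (m : ℝ) - 1) * π / β|} with hs
  have hsm : MeasurableSet s := by
    have : s = ⋂ m : ℕ, ⋂ _ : 1 ≤ m, {z : ℝ | ε ≤ |z - (2 * (m : ℝ) - 1) * π / β|} := by
      ext z; simp [hs]
    rw [this]
    exact MeasurableSet.iInter fun m => MeasurableSet.iInter fun _ =>
      measurableSet_le measurable_const (by fun_prop)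
  have hset : {z : ℝ | 0 < z ∧ ∀ m : ℕ, 1 ≤ m → ε ≤ |z - (2 * (m : ℝ) - 1) * π / β|} =
      Ioi 0 ∩ s := rfl
  rw [hset, ← setIntegral_indicator hsm]
  refine setIntegral_congr_fun measurableSet_Ioi fun x hx => ?_
  have hx : 0 < x := hx
  have hiff : x ∈ s ↔ ∀ m : ℤ, ε ≤ |x - (2 * (m : ℝ) - 1) * π / β| := by
    constructor
    · intro h m
      rcases le_or_gt m 0 with hm | hm
      · have hm' : (m : ℝ) ≤ 0 := by exact_mod_cast hm
        have hp : 0 < π / β := by positivity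
        refine le_trans ?_ (le_abs_self _)
        rw [mul_div_assoc]
        nlinarith
      · obtain ⟨k, rfl⟩ := Int.eq_ofNat_of_zero_le hm.le
        have := h k (by omega)
        simpa using this
    · intro h m _
      simpa using h m
  simp only [truncatedTan, indicator]
  by_cases hxs : x ∈ s
  · rw [if_pos hxs, if_pos (hiff.1 hxs), fermiWeight]
  · rw [if_neg hxs, if_neg (mt hiff.2 hxs)]
    simp

/-- Terms of the alternating double series `∑ (-1)^(k+l) (a k + i b l)^(-n)` over `k, l ≥ 1`. -/
noncomputable def altLatticeTerm (n : ℂ) (a b : ℝ) (p : ℕ × ℕ) : ℂ :=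
  (-1) ^ p.1 * (-1) ^ p.2 * (1 / ((a : ℂ) * (p.1 + 1) + b * (p.2 + 1) * Complex.I)) ^ n

/-- The alternating double series `∑ (-1)^(k+l) (a k + i b l)^(-n)` over `k, l ≥ 1`. -/
noncomputable def altLatticeSum (n : ℂ) (a b : ℝ) : ℂ := ∑' p, altLatticeTerm n a b p

theorem norm_cpow_le_of_re_pos (n : ℂ) (z : ℂ) :
    ‖z ^ n‖ ≤ Real.exp (π * |n.im|) * ‖z‖ ^ n.re := by
  refine (Complex.norm_cpow_le z n).trans ?_
  rw [div_eq_mul_inv, ← Real.exp_neg, mul_comm]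
  gcongr
  calc -(z.arg * n.im) ≤ |z.arg * n.im| := neg_le_abs _
    _ = |z.arg| * |n.im| := abs_mul _ _
    _ ≤ π * |n.im| := by gcongr; exact Complex.abs_arg_le_pi z

theorem norm_one_div_le {x y : ℝ} (hx : x ≠ 0) (hy : y ≠ 0) :
    ‖1 / ((x : ℂ) + y * Complex.I)‖ ≤ |x| ^ (-(1 / 2) : ℝ) * |y| ^ (-(1 / 2) : ℝ) := by
  have hx' := abs_pos.2 hx
  have hy' := abs_pos.2 hy
  rw [norm_div, norm_one, Complex.norm_add_mul_I, ← Real.mul_rpow hx'.le hy'.le,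
    Real.rpow_neg (by positivity), ← Real.sqrt_eq_rpow, one_div]
  gcongr
  rw [← sq_abs x, ← sq_abs y]
  nlinarith [sq_nonneg (|x| - |y|)]

theorem norm_altLatticeTerm (n : ℂ) (a b : ℝ) (p : ℕ × ℕ) :
    ‖altLatticeTerm n a b p‖ =
      ‖(1 / ((a : ℂ) * (p.1 + 1) + b * (p.2 + 1) * Complex.I)) ^ n‖ := by
  simp [altLatticeTerm]

theorem summable_norm_altLatticeTerm {n : ℂ} (hn : 2 < n.re) {a b : ℝ} (ha : a ≠ 0) (hb : b ≠ 0) :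
    Summable fun p => ‖altLatticeTerm n a b p‖ := by
  have hs : Summable fun k : ℕ => ((k : ℝ) + 1) ^ (-(n.re / 2)) := by
    have := (summable_nat_add_iff 1).2 (Real.summable_nat_rpow (p := -(n.re / 2)).2 (by linarith))
    simpa using this
  have hp := (hs.mul_of_nonneg hs (fun k => by positivity) (fun k => by positivity)).mul_left
    (Real.exp (π * |n.im|) * (|a| ^ (-(n.re / 2)) * |b| ^ (-(n.re / 2))))
  refine Summable.of_nonneg_of_le (fun _ => norm_nonneg _) (fun p => ?_) hp
  have hx : (0 : ℝ) < (p.1 : ℝ) + 1 := by positivity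
  have hy : (0 : ℝ) < (p.2 : ℝ) + 1 := by positivity
  have h1 := norm_one_div_le (mul_ne_zero ha hx.ne') (mul_ne_zero hb hy.ne')
  push_cast at h1
  rw [norm_altLatticeTerm]
  refine (norm_cpow_le_of_re_pos n _).trans ?_
  rw [mul_assoc (Real.exp _) (_ * _)]
  refine mul_le_mul_of_nonneg_left ?_ (Real.exp_pos _).le
  calc _ ≤ (|a * (p.1 + 1)| ^ (-(1 / 2) : ℝ) * |b * (p.2 + 1)| ^ (-(1 / 2) : ℝ)) ^ n.re := by
        gcongr
    _ = |a * (p.1 + 1)| ^ (-(n.re / 2)) * |b * (p.2 + 1)| ^ (-(n.re / 2)) := by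
        rw [Real.mul_rpow (by positivity) (by positivity), ← Real.rpow_mul (abs_nonneg _),
          ← Real.rpow_mul (abs_nonneg _)]
        ring_nf
    _ = _ := by
        rw [abs_mul, abs_mul, abs_of_pos hx, abs_of_pos hy,
          Real.mul_rpow (abs_nonneg _) hx.le, Real.mul_rpow (abs_nonneg _) hy.le]
        ring

theorem neg_exp_neg_pow (w : ℂ) (l : ℕ) :
    (-Complex.exp (-w)) ^ l * Complex.exp (-w) = (-1) ^ l * Complex.exp (-((l + 1) * w)) := by
  rw [neg_pow, ← Complex.exp_nat_mul, mul_assoc, ← Complex.exp_add]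
  ring_nf

theorem norm_neg_exp_neg_lt_one {w : ℂ} (hw : 0 < w.re) : ‖-Complex.exp (-w)‖ < 1 := by
  rw [norm_neg, Complex.norm_exp]
  simpa using hw

theorem hasSum_fermi {w : ℂ} (hw : 0 < w.re) :
    HasSum (fun l : ℕ => (-1) ^ l * Complex.exp (-((l + 1) * w))) (1 / (Complex.exp w + 1)) := by
  have h := (hasSum_geometric_of_norm_lt_one (norm_neg_exp_neg_lt_one hw)).mul_right
    (Complex.exp (-w))
  simp only [neg_exp_neg_pow] at h
  have h0 : 1 + Complex.exp (-w) ≠ 0 := fun h' => by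
    have := norm_neg_exp_neg_lt_one hw
    rw [← eq_neg_iff_add_eq_zero.2 h'] at this
    simp at this
  have h1 : Complex.exp w + 1 = (1 + Complex.exp (-w)) * Complex.exp w := by
    rw [add_mul, ← Complex.exp_add]; simp
  rwa [sub_neg_eq_add, Complex.exp_neg, ← mul_inv, ← Complex.exp_neg, ← h1, ← one_div] at h

theorem summable_norm_fermi {w : ℂ} (hw : 0 < w.re) :
    Summable fun l : ℕ => ‖(-1) ^ l * Complex.exp (-((l + 1) * w))‖ := by
  simp only [← neg_exp_neg_pow, norm_mul _ (Complex.exp (-w)), norm_pow]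
  exact (summable_geometric_of_lt_one (norm_nonneg _) (norm_neg_exp_neg_lt_one hw)).mul_right _

/-- The integral of the weight against the regularised geometric series in `exp (i b x)`. -/
theorem integral_fermiWeight_mul_regularized {n : ℂ} (hn : 1 < n.re) (b : ℝ) {δ : ℝ} (hδ : 0 < δ) :
    Integrable (fun x : ℝ => fermiWeight n x * (1 / (Complex.exp (δ + b * x * Complex.I) + 1)))
        (volume.restrict (Ioi 0)) ∧
    ∫ x in Ioi 0, fermiWeight n x * (1 / (Complex.exp (δ + b * x * Complex.I) + 1)) =
      Complex.Gamma n *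
        ∑' p : ℕ × ℕ, Complex.exp (-((p.2 + 1) * δ)) * altLatticeTerm n (2 * π) b p := by
  set G : ℕ × ℕ → ℝ → ℂ := fun p x => (x : ℂ) ^ (n - 1) *
    (((-1) ^ p.1 * Complex.exp (-((p.1 + 1) * (2 * π * x)))) *
      ((-1) ^ p.2 * Complex.exp (-((p.2 + 1) * (δ + b * x * Complex.I))))) with hG
  have hre2 : ∀ x : ℝ, (δ + b * x * Complex.I : ℂ).re = δ := fun x => by simp
  have hGeq : ∀ p x, G p x = ((-1) ^ p.1 * (-1) ^ p.2 * Complex.exp (-((p.2 + 1) * δ))) *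
      ((x : ℂ) ^ (n - 1) * Complex.exp
        (-((((2 * π : ℝ) : ℂ) * (p.1 + 1) + b * (p.2 + 1) * Complex.I) * x))) := by
    intro p x
    have : Complex.exp (-((p.1 + 1) * (2 * π * x))) *
        Complex.exp (-((p.2 + 1) * (δ + b * x * Complex.I))) =
        Complex.exp (-((p.2 + 1) * δ)) * Complex.exp
        (-((((2 * π : ℝ) : ℂ) * (p.1 + 1) + b * (p.2 + 1) * Complex.I) * x)) := by
      rw [← Complex.exp_add, ← Complex.exp_add]
      push_cast
      ring_nf
    linear_combination ((x : ℂ) ^ (n - 1) * (-1) ^ p.1 * (-1) ^ p.2) * this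
  have hGnorm : ∀ p, ∀ x ∈ Ioi (0 : ℝ), ‖G p x‖ =
      Real.exp (-((p.2 + 1) * δ)) *
        (x ^ (n.re - 1) * Real.exp (-((2 * π * (p.1 + 1)) * x))) := by
    intro p x hx
    simp only [hGeq, norm_mul, Complex.norm_exp, Complex.norm_cpow_eq_rpow_re_of_pos hx]
    simp
  have hGint : ∀ p, Integrable (G p) (volume.restrict (Ioi 0)) := by
    intro p
    refine Integrable.mono' ((integrableOn_rpow_mul_exp_neg_mul (s := n.re - 1)
      (b := 2 * π * (p.1 + 1)) (by linarith) (by positivity)).const_mul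
      (Real.exp (-((p.2 + 1) * δ)))) (Measurable.aestronglyMeasurable ?_)
      (ae_restrict_of_forall_mem measurableSet_Ioi fun x hx => (hGnorm p x hx).le)
    simp only [hG]
    fun_prop
  have hGi : ∀ p, ∫ x in Ioi 0, ‖G p x‖ = Real.exp (-δ) ^ (p.2 + 1) *
      (((p.1 : ℝ) + 1) ^ (-n.re) * ((1 / (2 * π)) ^ n.re * Real.Gamma n.re)) := by
    intro p
    rw [setIntegral_congr_fun measurableSet_Ioi (hGnorm p), integral_const_mul,
      Real.integral_rpow_mul_exp_neg_mul_Ioi (by linarith) (by positivity), ← Real.exp_nat_mul,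
      show 1 / (2 * π * ((p.1 : ℝ) + 1)) = ((p.1 : ℝ) + 1)⁻¹ * (1 / (2 * π)) by field_simp,
      Real.mul_rpow (by positivity) (by positivity), Real.inv_rpow (by positivity),
      ← Real.rpow_neg (by positivity)]
    push_cast
    ring_nf
  have hs1 : Summable fun k : ℕ => ((k : ℝ) + 1) ^ (-n.re) *
      ((1 / (2 * π)) ^ n.re * Real.Gamma n.re) := by
    have := (summable_nat_add_iff 1).2 (Real.summable_nat_rpow (p := -n.re).2 (by linarith))
    exact Summable.mul_right _ (by simpa using this)
  have hs2 : Summable fun l : ℕ => Real.exp (-δ) ^ (l + 1) :=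
    (summable_nat_add_iff 1).2 (summable_geometric_of_lt_one (Real.exp_pos _).le
      (by simpa using hδ))
  have hsum : Summable fun p : ℕ × ℕ => ∫ x in Ioi 0, ‖G p x‖ := by
    simp only [hGi]
    have hΓ := (Real.Gamma_pos_of_pos (s := n.re) (by linarith)).le
    have := hs1.mul_of_nonneg hs2 (fun k => by positivity) (fun l => by positivity)
    exact this.congr fun p => mul_comm _ _
  have hpt : ∀ x ∈ Ioi (0 : ℝ), ∑' p, G p x =
      fermiWeight n x * (1 / (Complex.exp (δ + b * x * Complex.I) + 1)) := by
    intro x hx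
    have hx : 0 < x := hx
    have hw1 : 0 < (2 * π * x : ℂ).re := by
      have : (2 * π * x : ℂ) = ((2 * π * x : ℝ) : ℂ) := by push_cast; rfl
      rw [this, Complex.ofReal_re]; positivity
    have hw2 : 0 < (δ + b * x * Complex.I : ℂ).re := by rw [hre2]; exact hδ
    have hs := summable_mul_of_summable_norm (summable_norm_fermi hw1) (summable_norm_fermi hw2)
    have hm := (hasSum_fermi hw1).mul (hasSum_fermi hw2) hs
    rw [(hm.mul_left ((x : ℂ) ^ (n - 1))).tsum_eq, fermiWeight]
    push_cast
    ring
  have hmain := hasSum_integral_of_summable_integral_norm hGint hsum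
  refine ⟨?_, ?_⟩
  · have hden : ∀ x : ℝ, Real.exp δ - 1 ≤ ‖Complex.exp (δ + b * x * Complex.I) + 1‖ := by
      intro x
      have h1 := norm_sub_le (Complex.exp (δ + b * x * Complex.I) + 1) 1
      rw [add_sub_cancel_right, Complex.norm_exp, hre2, norm_one] at h1
      linarith
    have hd0 : 0 < Real.exp δ - 1 := by
      have := Real.one_lt_exp_iff.2 hδ
      linarith
    refine Integrable.mul_bdd (c := 1 / (Real.exp δ - 1)) (integrableOn_fermiWeight (by linarith))
      (Measurable.aestronglyMeasurable (by fun_prop)) (Eventually.of_forall fun x => ?_)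
    rw [norm_div, norm_one]
    exact one_div_le_one_div_of_le hd0 (hden x)
  · rw [← setIntegral_congr_fun measurableSet_Ioi hpt, ← hmain.tsum_eq, ← tsum_mul_left]
    refine tsum_congr fun p => ?_
    have hr : 0 < (((2 * π : ℝ) : ℂ) * (p.1 + 1) + b * (p.2 + 1) * Complex.I).re := by
      simp
      positivity
    simp only [hGeq]
    rw [integral_const_mul, integral_cpow_mul_exp_neg_complex_mul_Ioi (by linarith) hr,
      altLatticeTerm]
    ring

theorem tendsto_tsum_regularized {n : ℂ} (hn : 2 < n.re) {a b : ℝ} (ha : a ≠ 0) (hb : b ≠ 0) :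
    Tendsto (fun δ : ℝ => ∑' p : ℕ × ℕ,
        Complex.exp (-((p.2 + 1) * δ)) * altLatticeTerm n a b p) (𝓝[>] 0)
      (𝓝 (altLatticeSum n a b)) := by
  refine tendsto_tsum_of_dominated_convergence (summable_norm_altLatticeTerm hn ha hb)
    (fun p => ?_) ?_
  · refine tendsto_nhdsWithin_of_tendsto_nhds ?_
    have : Continuous fun δ : ℝ => Complex.exp (-((p.2 + 1) * δ)) * altLatticeTerm n a b p := by
      fun_prop
    simpa using this.tendsto 0
  · filter_upwards [self_mem_nhdsWithin] with δ hδ p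
    have hδ : 0 < δ := hδ
    rw [norm_mul, Complex.norm_exp]
    refine mul_le_of_le_one_left (norm_nonneg _) (Real.exp_le_one_iff.2 ?_)
    have : (-(((p.2 : ℂ) + 1) * δ)).re = -((p.2 + 1) * δ) := by simp
    rw [this]
    have : 0 ≤ ((p.2 : ℝ) + 1) * δ := by positivity
    linarith

theorem regularizedTan_eq (β x : ℝ) {δ : ℝ} (hδ : 0 < δ) :
    (regularizedTan β δ x : ℂ) =
      Complex.I * (1 / (Complex.exp (δ + β * x * Complex.I) + 1)) -
      Complex.I * (1 / (Complex.exp (δ + (-β : ℝ) * x * Complex.I) + 1)) := by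
  have hne : ∀ y : ℝ, Complex.exp (δ + y * x * Complex.I) + 1 ≠ 0 := by
    intro y h
    have h1 := congrArg norm (eq_neg_of_add_eq_zero_left h)
    rw [Complex.norm_exp] at h1
    simp at h1
    exact hδ.ne' h1
  have h1 := hne β
  have h2 := hne (-β)
  have hc : (0 : ℝ) < Real.cosh δ + Real.cos (β * x) := by
    linarith [Real.one_lt_cosh.2 hδ.ne', Real.neg_one_le_cos (β * x)]
  have hc' : Complex.cosh δ + Complex.cos (β * x) ≠ 0 := by
    exact_mod_cast hc.ne'
  rw [regularizedTan]
  push_cast at h1 h2 ⊢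
  have e1 : Complex.exp (δ + β * x * Complex.I) = Complex.exp δ * Complex.exp (β * x * Complex.I) :=
    Complex.exp_add _ _
  have e2 : Complex.exp (δ + -β * x * Complex.I) =
      Complex.exp δ * Complex.exp (-(β * x) * Complex.I) := by
    rw [← Complex.exp_add]; ring_nf
  have e3 : Complex.exp (β * x * Complex.I) * Complex.exp (-(β * x) * Complex.I) = 1 := by
    rw [← Complex.exp_add]; simp
  have e4 : Complex.exp δ * Complex.exp (-δ) = 1 := by rw [← Complex.exp_add]; simp
  rw [mul_one_div, mul_one_div, div_sub_div _ _ h1 h2, div_eq_div_iff hc' (mul_ne_zero h1 h2)]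
  rw [e1, e2, Complex.sin, Complex.cos, Complex.cosh]
  generalize Complex.exp (δ : ℂ) = D at *
  generalize Complex.exp (-δ : ℂ) = D' at *
  generalize Complex.exp (β * x * Complex.I) = E at *
  generalize Complex.exp (-(β * x) * Complex.I) = E' at *
  linear_combination (E' - E) * Complex.I / 2 * D ^ 2 * e3 - (E' - E) * Complex.I / 2 * e4

theorem tendsto_integral_regularizedTan {n : ℂ} (hn : 2 < n.re) {β : ℝ} (hβ : 0 < β) :
    Tendsto (fun δ => ∫ x in Ioi 0, fermiWeight n x * regularizedTan β δ x) (𝓝[>] 0)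
      (𝓝 (Complex.I * Complex.Gamma n *
        (altLatticeSum n (2 * π) β - altLatticeSum n (2 * π) (-β)))) := by
  have h2π : (2 * π : ℝ) ≠ 0 := by positivity
  have h1 := (tendsto_tsum_regularized hn h2π hβ.ne').const_mul (Complex.Gamma n)
  have h2 := (tendsto_tsum_regularized hn h2π (neg_ne_zero.2 hβ.ne')).const_mul (Complex.Gamma n)
  have h := (h1.sub h2).const_mul Complex.I
  rw [← mul_sub, ← mul_assoc] at h
  refine h.congr' ?_
  filter_upwards [self_mem_nhdsWithin] with δ hδ
  obtain ⟨i1, j1⟩ := integral_fermiWeight_mul_regularized (n := n) (by linarith) β hδ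
  obtain ⟨i2, j2⟩ := integral_fermiWeight_mul_regularized (n := n) (by linarith) (-β) hδ
  rw [← j1, ← j2, ← integral_sub i1 i2, ← integral_const_mul]
  refine integral_congr_ae (Eventually.of_forall fun x => ?_)
  simp only [regularizedTan_eq β x hδ]
  ring


/-- The function equal to `x^(n-1) e^(-w x)` for `x > 0` and to zero elsewhere. -/
noncomputable def gammaKernel (n : ℂ) (w x : ℝ) : ℂ :=
  ((max x 0 : ℝ) : ℂ) ^ (n - 1) * Complex.exp (-(w * x))

theorem gammaKernel_of_pos (n : ℂ) (w : ℝ) {x : ℝ} (hx : 0 < x) :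
    gammaKernel n w x = (x : ℂ) ^ (n - 1) * Complex.exp (-(w * x)) := by
  rw [gammaKernel, max_eq_left hx.le]

theorem gammaKernel_of_nonpos {n : ℂ} (hn : 2 < n.re) (w : ℝ) {x : ℝ} (hx : x ≤ 0) :
    gammaKernel n w x = 0 := by
  have h : n - 1 ≠ 0 := fun h => by
    have := congrArg Complex.re h
    simp at this
    linarith
  rw [gammaKernel, max_eq_right hx, Complex.ofReal_zero, Complex.zero_cpow h, zero_mul]

theorem continuous_gammaKernel {n : ℂ} (hn : 2 < n.re) (w : ℝ) :
    Continuous (gammaKernel n w) := by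
  have h : 0 < (n - 1).re := by simp; linarith
  have h1 := (Complex.continuous_ofReal_cpow_const h).comp (continuous_id.max continuous_const :
    Continuous fun x : ℝ => max x 0)
  exact h1.mul (by fun_prop)

theorem norm_gammaKernel_of_pos (n : ℂ) (w : ℝ) {x : ℝ} (hx : 0 < x) :
    ‖gammaKernel n w x‖ = x ^ (n.re - 1) * Real.exp (-(w * x)) := by
  rw [gammaKernel_of_pos n w hx, norm_mul, Complex.norm_cpow_eq_rpow_re_of_pos hx,
    Complex.norm_exp]
  simp

theorem norm_gammaKernel_le {n : ℂ} (hn : 2 < n.re) {w : ℝ} (hw : 0 < w) (x : ℝ) :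
    ‖gammaKernel n w x‖ ≤ (n.re + 1) ^ (n.re + 1) / w ^ (n.re + 1) * |x| ^ (-2 : ℝ) := by
  rcases le_or_gt x 0 with hx | hx
  · rw [gammaKernel_of_nonpos hn w hx, norm_zero]
    positivity
  · have h := rpow_le_mul_exp (a := n.re + 1) (x := w * x) (by linarith) (by positivity)
    rw [norm_gammaKernel_of_pos n w hx, abs_of_pos hx]
    rw [Real.mul_rpow hw.le hx.le] at h
    have h2 : x ^ (n.re - 1) = x ^ (n.re + 1) * x ^ (-2 : ℝ) := by
      rw [← Real.rpow_add hx]; ring_nf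
    rw [h2, Real.exp_neg, mul_right_comm]
    gcongr
    rw [← div_eq_mul_inv, div_le_div_iff₀ (Real.exp_pos _) (by positivity), mul_comm]
    exact h

theorem isBigO_gammaKernel {n : ℂ} (hn : 2 < n.re) {w : ℝ} (hw : 0 < w) :
    gammaKernel n w =O[cocompact ℝ] fun x => |x| ^ (-2 : ℝ) := by
  refine Asymptotics.IsBigO.of_bound ((n.re + 1) ^ (n.re + 1) / w ^ (n.re + 1))
    (Eventually.of_forall fun x => ?_)
  rw [Real.norm_of_nonneg (by positivity)]
  exact norm_gammaKernel_le hn hw x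

open FourierTransform in
theorem fourier_gammaKernel {n : ℂ} (hn : 2 < n.re) {w : ℝ} (hw : 0 < w) (k : ℝ) :
    𝓕 (gammaKernel n w) k =
      (1 / ((w : ℂ) + 2 * π * k * Complex.I)) ^ n * Complex.Gamma n := by
  rw [Real.fourier_real_eq_integral_exp_smul, ← integral_cpow_mul_exp_neg_complex_mul_Ioi
    (by linarith) (by simpa using hw), ← setIntegral_eq_integral_of_forall_compl_eq_zero
    (s := Ioi 0)]
  · refine setIntegral_congr_fun measurableSet_Ioi fun t ht => ?_
    simp only [smul_eq_mul]
    rw [gammaKernel_of_pos n w ht, mul_left_comm, ← Complex.exp_add]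
    congr 2
    push_cast
    ring
  · intro x hx
    rw [gammaKernel_of_nonpos hn w (not_lt.1 hx), smul_zero]

theorem norm_one_div_cpow_le {n : ℂ} (hn : 2 < n.re) (w : ℝ) {y : ℝ} (hy : y ≠ 0) :
    ‖(1 / ((w : ℂ) + y * Complex.I)) ^ n‖ ≤ Real.exp (π * |n.im|) * |y| ^ (-n.re) := by
  refine (norm_cpow_le_of_re_pos n _).trans ?_
  gcongr
  rw [Real.rpow_neg (abs_nonneg _), ← Real.inv_rpow (abs_nonneg _)]
  gcongr
  rw [norm_div, norm_one, one_div]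
  gcongr
  simpa using Complex.abs_im_le_norm ((w : ℂ) + y * Complex.I)

theorem summable_one_div_add_int_cpow {n : ℂ} (hn : 2 < n.re) (w : ℝ) :
    Summable fun k : ℤ => (1 / ((w : ℂ) + 2 * π * k * Complex.I)) ^ n := by
  refine Summable.of_norm_bounded_eventually
    (g := fun k : ℤ => Real.exp (π * |n.im|) * (2 * π) ^ (-n.re) * |(k : ℝ)| ^ (-n.re))
    ((Real.summable_abs_int_rpow (by linarith)).mul_left _) ?_
  have : ∀ᶠ k : ℤ in cofinite, k ≠ 0 := by
    simpa using (Set.finite_singleton (0 : ℤ)).compl_mem_cofinite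
  filter_upwards [this] with k hk
  have h := norm_one_div_cpow_le hn w (y := 2 * π * k)
    (mul_ne_zero (by positivity) (by exact_mod_cast hk))
  rw [abs_mul, abs_of_pos Real.two_pi_pos,
    Real.mul_rpow Real.two_pi_pos.le (abs_nonneg _), ← mul_assoc] at h
  exact_mod_cast h


theorem tsum_int_gammaKernel {n : ℂ} (hn : 2 < n.re) (w : ℝ) :
    ∑' k : ℤ, gammaKernel n w (1 / 2 + k) =
      ∑' j : ℕ, (((j : ℝ) + 1 / 2 : ℝ) : ℂ) ^ (n - 1) *
        Complex.exp (-(w * ((j : ℝ) + 1 / 2 : ℝ))) := by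
  rw [← Function.Injective.tsum_eq (g := fun j : ℕ => (j : ℤ)) Nat.cast_injective]
  · refine tsum_congr fun j => ?_
    have hj : (1 / 2 + ((j : ℤ) : ℝ) : ℝ) = (j : ℝ) + 1 / 2 := by push_cast; ring
    rw [hj, gammaKernel_of_pos n w (by positivity)]
  · intro k hk
    by_contra hk'
    refine hk (gammaKernel_of_nonpos hn w ?_)
    have : k ≤ -1 := by
      by_contra hlt
      exact hk' ⟨k.toNat, by simp; omega⟩
    have : (k : ℝ) ≤ -1 := by exact_mod_cast this
    linarith

theorem tsum_int_alternating {n : ℂ} (hn : 2 < n.re) (w : ℝ) :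
    ∑' k : ℤ, (1 / ((w : ℂ) + 2 * π * k * Complex.I)) ^ n * (-1) ^ k =
      (1 / (w : ℂ)) ^ n
        - ∑' k : ℕ, (-1) ^ k * (1 / ((w : ℂ) + (2 * π : ℝ) * (k + 1) * Complex.I)) ^ n
        - ∑' k : ℕ, (-1) ^ k * (1 / ((w : ℂ) + (-(2 * π) : ℝ) * (k + 1) * Complex.I)) ^ n := by
  have hs' : Summable fun k : ℤ =>
      (1 / ((w : ℂ) + 2 * π * k * Complex.I)) ^ n * (-1) ^ k := by
    refine Summable.of_norm ((summable_one_div_add_int_cpow hn w).norm.congr fun k => ?_)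
    rw [norm_mul, norm_zpow, norm_neg, norm_one, one_zpow, mul_one]
  have h1 : ∀ k : ℕ, (1 / ((w : ℂ) + 2 * π * (((k : ℤ) + 1 : ℤ) : ℂ) * Complex.I)) ^ n *
      (-1) ^ ((k : ℤ) + 1) =
      -((-1) ^ k * (1 / ((w : ℂ) + (2 * π : ℝ) * (k + 1) * Complex.I)) ^ n) := fun k => by
    rw [zpow_add₀ (by norm_num), zpow_natCast, zpow_one]
    push_cast
    ring
  have h2 : ∀ k : ℕ, (1 / ((w : ℂ) + 2 * π * ((-((k : ℤ) + 1) : ℤ) : ℂ) * Complex.I)) ^ n *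
      (-1) ^ (-((k : ℤ) + 1)) =
      -((-1) ^ k * (1 / ((w : ℂ) + (-(2 * π) : ℝ) * (k + 1) * Complex.I)) ^ n) := fun k => by
    rw [zpow_neg, ← inv_zpow, inv_neg_one, zpow_add₀ (by norm_num), zpow_natCast, zpow_one]
    push_cast
    ring_nf
  have hp : Summable fun m : ℕ =>
      (1 / ((w : ℂ) + 2 * π * (((m : ℤ) + 1 : ℤ) : ℂ) * Complex.I)) ^ n * (-1) ^ ((m : ℤ) + 1) :=
    hs'.comp_injective (i := fun m : ℕ => (m : ℤ) + 1) fun a b => by simp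
  have hm : Summable fun m : ℕ =>
      (1 / ((w : ℂ) + 2 * π * ((-((m : ℤ) + 1) : ℤ) : ℂ) * Complex.I)) ^ n *
        (-1) ^ (-((m : ℤ) + 1)) :=
    hs'.comp_injective (i := fun m : ℕ => -((m : ℤ) + 1)) fun a b => by simp
  rw [tsum_of_add_one_of_neg_add_one
    (f := fun k : ℤ => (1 / ((w : ℂ) + 2 * π * k * Complex.I)) ^ n * (-1) ^ k) hp hm,
    tsum_congr h1, tsum_congr h2, tsum_neg, tsum_neg]
  simp only [Int.cast_zero, mul_zero, zero_mul, add_zero, zpow_zero, mul_one]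
  ring

/-- **Lipschitz summation formula**, shifted by one half. -/
theorem lipschitz_summation {n : ℂ} (hn : 2 < n.re) {w : ℝ} (hw : 0 < w) :
    ∑' j : ℕ, (((j : ℝ) + 1 / 2 : ℝ) : ℂ) ^ (n - 1) * Complex.exp (-(w * ((j : ℝ) + 1 / 2 : ℝ))) =
      Complex.Gamma n * ((1 / (w : ℂ)) ^ n
        - ∑' k : ℕ, (-1) ^ k * (1 / ((w : ℂ) + (2 * π : ℝ) * (k + 1) * Complex.I)) ^ n
        - ∑' k : ℕ, (-1) ^ k * (1 / ((w : ℂ) + (-(2 * π) : ℝ) * (k + 1) * Complex.I)) ^ n) := by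
  have hF : ∀ k : ℤ, FourierTransform.fourier (gammaKernel n w) (k : ℝ) =
      (1 / ((w : ℂ) + 2 * π * k * Complex.I)) ^ n * Complex.Gamma n := fun k => by
    rw [fourier_gammaKernel hn hw, Complex.ofReal_intCast]
  have hexp : ∀ k : ℤ, fourier k (((1 / 2 : ℝ)) : UnitAddCircle) = (-1 : ℂ) ^ k := fun k => by
    rw [fourier_coe_apply, ← Complex.exp_pi_mul_I, ← Complex.exp_int_mul]
    congr 1
    push_cast
    ring
  have hs : Summable fun k : ℤ => FourierTransform.fourier (gammaKernel n w) (k : ℝ) := by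
    simp only [hF]
    exact (summable_one_div_add_int_cpow hn w).mul_right _
  have h := Real.tsum_eq_tsum_fourier_of_rpow_decay_of_summable (continuous_gammaKernel hn w)
    one_lt_two (isBigO_gammaKernel hn hw) hs (1 / 2)
  have hr : ∀ k : ℤ, FourierTransform.fourier (gammaKernel n w) (k : ℝ) *
      fourier k (((1 / 2 : ℝ)) : UnitAddCircle) =
      Complex.Gamma n * ((1 / ((w : ℂ) + 2 * π * k * Complex.I)) ^ n * (-1) ^ k) := fun k => by
    rw [hF, hexp]; ring
  rw [← tsum_int_gammaKernel hn, h, tsum_congr hr, tsum_mul_left, tsum_int_alternating hn]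

theorem one_div_nat_add_one_cpow (n : ℂ) (l : ℕ) :
    (1 / ((l : ℂ) + 1)) ^ n = 1 / ((l : ℂ) + 1) ^ n := by
  have h : (l : ℂ) + 1 = ((l + 1 : ℕ) : ℂ) := by push_cast; ring
  rw [one_div, one_div, h, Complex.inv_cpow _ _ (by rw [Complex.natCast_arg]; exact Real.pi_pos.ne)]

theorem summable_one_div_nat_add_one_cpow {n : ℂ} (hn : 1 < n.re) :
    Summable fun l : ℕ => 1 / ((l : ℂ) + 1) ^ n := by
  simpa using (summable_nat_add_iff 1).2 (Complex.summable_one_div_nat_cpow.2 hn)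

theorem summable_alternating_one_div_cpow {n : ℂ} (hn : 1 < n.re) :
    Summable fun l : ℕ => (-1) ^ l * (1 / ((l : ℂ) + 1)) ^ n := by
  refine Summable.of_norm ((summable_one_div_nat_add_one_cpow hn).norm.congr fun l => ?_)
  rw [norm_mul, norm_pow, norm_neg, norm_one, one_pow, one_mul, one_div_nat_add_one_cpow]

theorem tsum_alternating_one_div_cpow {n : ℂ} (hn : 1 < n.re) :
    ∑' l : ℕ, (-1) ^ l * (1 / ((l : ℂ) + 1)) ^ n = (1 - 2 ^ (1 - n)) * riemannZeta n := by
  have hinv := one_div_nat_add_one_cpow n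
  have hs := summable_one_div_nat_add_one_cpow hn
  have he : Summable fun k : ℕ => 1 / (((2 * k : ℕ) : ℂ) + 1) ^ n :=
    hs.comp_injective (i := fun k => 2 * k) fun a b => by simp
  have ho : Summable fun k : ℕ => 1 / (((2 * k + 1 : ℕ) : ℂ) + 1) ^ n :=
    hs.comp_injective (i := fun k => 2 * k + 1) fun a b => by simp
  have hz := tsum_even_add_odd (f := fun l : ℕ => 1 / ((l : ℂ) + 1) ^ n) he ho
  have hsg := tsum_even_add_odd (f := fun l : ℕ => (-1) ^ l * (1 / ((l : ℂ) + 1)) ^ n)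
    (he.congr fun k => by rw [hinv, pow_mul]; simp)
    (ho.neg.congr fun k => by rw [hinv, pow_succ, pow_mul]; simp)
  have h1 : ∀ k : ℕ, (-1 : ℂ) ^ (2 * k) * (1 / (((2 * k : ℕ) : ℂ) + 1)) ^ n =
      1 / (((2 * k : ℕ) : ℂ) + 1) ^ n := fun k => by rw [hinv, pow_mul]; simp
  have h2 : ∀ k : ℕ, (-1 : ℂ) ^ (2 * k + 1) * (1 / (((2 * k + 1 : ℕ) : ℂ) + 1)) ^ n =
      -(1 / (((2 * k + 1 : ℕ) : ℂ) + 1) ^ n) := fun k => by rw [hinv, pow_succ, pow_mul]; simp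
  have h3 : ∀ k : ℕ, 1 / (((2 * k + 1 : ℕ) : ℂ) + 1) ^ n =
      (1 / 2 ^ n) * (1 / ((k : ℂ) + 1) ^ n) := fun k => by
    have h : ((2 * k + 1 : ℕ) : ℂ) + 1 = ((2 : ℝ) : ℂ) * ((k + 1 : ℝ) : ℂ) := by push_cast; ring
    rw [h, Complex.mul_cpow_ofReal_nonneg (by norm_num) (by positivity)]
    push_cast
    rw [one_div_mul_one_div]
  rw [tsum_congr h1, tsum_congr h2, tsum_neg] at hsg
  simp only [tsum_congr h3, tsum_mul_left, ← zeta_eq_tsum_one_div_nat_add_one_cpow hn] at hz hsg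
  rw [← hsg, Complex.cpow_sub _ _ two_ne_zero, Complex.cpow_one]
  linear_combination hz

/-- Complex powers are multiplicative when the first factor lies in the closed right half-plane and
the second in the open one. -/
theorem mul_cpow_of_re_pos {c z : ℂ} (hc0 : c ≠ 0) (hc : |c.arg| ≤ π / 2) (hz : 0 < z.re) (n : ℂ) :
    (c * z) ^ n = c ^ n * z ^ n := by
  have hz0 : z ≠ 0 := fun h => by simp [h] at hz
  have h := Complex.abs_arg_lt_pi_div_two_iff.2 (Or.inl hz)
  rw [Complex.cpow_def_of_ne_zero (mul_ne_zero hc0 hz0), Complex.cpow_def_of_ne_zero hc0,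
    Complex.cpow_def_of_ne_zero hz0, ← Complex.exp_add, ← add_mul,
    (Complex.log_mul_eq_add_log_iff hc0 hz0).2]
  rw [abs_le] at hc
  rw [abs_lt] at h
  exact ⟨by linarith, by linarith⟩

theorem one_div_add_mul_I_re_pos {x : ℝ} (hx : 0 < x) (y : ℝ) :
    0 < (1 / ((x : ℂ) + y * Complex.I)).re := by
  rw [one_div, Complex.inv_re]
  have h : ((x : ℂ) + y * Complex.I).re = x := by simp
  have h0 : (x : ℂ) + y * Complex.I ≠ 0 := fun h0 => by simp [h0] at h; linarith
  rw [h]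
  exact div_pos hx (Complex.normSq_pos.2 h0)

theorem mul_altLatticeTerm {c : ℂ} (hc0 : c ≠ 0) (hc : |c.arg| ≤ π / 2) (n : ℂ) {a : ℝ}
    (ha : 0 < a) (b : ℝ) (p : ℕ × ℕ) :
    c ^ n * altLatticeTerm n a b p = (-1) ^ p.1 * (-1) ^ p.2 *
      (c * (1 / ((a : ℂ) * (p.1 + 1) + b * (p.2 + 1) * Complex.I))) ^ n := by
  have h := one_div_add_mul_I_re_pos (x := a * (p.1 + 1)) (by positivity) (b * (p.2 + 1))
  push_cast at h
  rw [mul_cpow_of_re_pos hc0 hc h, altLatticeTerm]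
  ring

theorem mul_altLatticeSum_of_pos (n : ℂ) {a b a' b' r : ℝ} (ha : 0 < a) (hr : 0 < r)
    (hra : r * a' = a) (hrb : r * b' = b) :
    (r : ℂ) ^ n * altLatticeSum n a b = altLatticeSum n a' b' := by
  rw [altLatticeSum, altLatticeSum, ← tsum_mul_left]
  refine tsum_congr fun p => ?_
  have hr' : (r : ℂ) ≠ 0 := by exact_mod_cast hr.ne'
  rw [mul_altLatticeTerm hr' (by rw [Complex.arg_ofReal_of_nonneg hr.le]; simp; positivity) n ha,
    altLatticeTerm, ← hra, ← hrb]
  congr 2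
  rw [mul_one_div, ← div_div_div_cancel_right₀ hr', div_self hr']
  congr 1
  push_cast
  field_simp

theorem altLatticeSum_swap_of_mul {n c : ℂ} {a b a' b' : ℝ} (hc0 : c ≠ 0) (hc : |c.arg| ≤ π / 2)
    (ha : 0 < a) (h1 : (a : ℂ) = c * b' * Complex.I) (h2 : b * Complex.I = c * a') :
    c ^ n * altLatticeSum n a b = altLatticeSum n a' b' := by
  rw [altLatticeSum, altLatticeSum, ← tsum_mul_left, ← (Equiv.prodComm ℕ ℕ).tsum_eq]
  refine tsum_congr fun p => ?_
  rw [mul_altLatticeTerm hc0 hc n ha, altLatticeTerm]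
  simp only [Equiv.prodComm_apply, Prod.fst_swap, Prod.snd_swap]
  rw [mul_comm ((-1 : ℂ) ^ p.2)]
  congr 2
  rw [mul_one_div, h1, mul_right_comm (b : ℂ), h2, show c * b' * Complex.I * ((p.2 : ℂ) + 1) +
    c * a' * (p.1 + 1) = c * (a' * (p.1 + 1) + b' * (p.2 + 1) * Complex.I) by ring,
    ← div_div, div_self hc0]

theorem summable_fermi_expansion {n : ℂ} (hn : 2 < n.re) {a : ℝ} (ha : 0 < a) :
    Summable fun p : ℕ × ℕ => (-1 : ℂ) ^ p.1 * ((((p.2 : ℝ) + 1 / 2 : ℝ) : ℂ) ^ (n - 1) *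
      Complex.exp (-(((a * (p.1 + 1) : ℝ) : ℂ) * ((p.2 : ℝ) + 1 / 2 : ℝ)))) := by
  have hj : Summable fun j : ℕ => ‖gammaKernel n a ((j : ℝ) + 1 / 2)‖ := by
    refine Summable.of_nonneg_of_le (fun _ => norm_nonneg _)
      (fun j => norm_gammaKernel_le hn ha _) (Summable.mul_left _ ?_)
    refine ((Real.summable_one_div_nat_add_rpow (1 / 2) 2).2 one_lt_two).congr fun j => ?_
    rw [Real.rpow_neg (abs_nonneg _), one_div]
  have hl : Summable fun l : ℕ => Real.exp (-(a / 2)) ^ l :=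
    summable_geometric_of_lt_one (Real.exp_pos _).le (by rw [Real.exp_lt_one_iff]; linarith)
  refine Summable.of_norm_bounded (hl.mul_of_nonneg hj (fun _ => by positivity)
    (fun _ => norm_nonneg _)) fun p => ?_
  have hp : (0 : ℝ) < (p.2 : ℝ) + 1 / 2 := by positivity
  rw [norm_mul, norm_pow, norm_neg, norm_one, one_pow, one_mul, ← gammaKernel_of_pos n _ hp,
    norm_gammaKernel_of_pos n _ hp, norm_gammaKernel_of_pos n _ hp, mul_left_comm,
    ← Real.exp_nat_mul, ← Real.exp_add]
  gcongr
  have : (0 : ℝ) ≤ p.1 * a * p.2 := by positivity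
  linarith

theorem tsum_fermi_eq {n : ℂ} (hn : 2 < n.re) {a : ℝ} (ha : 0 < a) :
    ∑' j : ℕ, ((((j : ℝ) + 1) - 1 / 2 : ℝ) : ℂ) ^ (n - 1) /
        (((Real.exp (a * (((j : ℝ) + 1) - 1 / 2)) : ℝ) : ℂ) + 1) =
      Complex.Gamma n * ((1 / (a : ℂ)) ^ n * ((1 - 2 ^ (1 - n)) * riemannZeta n)
        - altLatticeSum n a (2 * π) - altLatticeSum n a (-(2 * π))) := by
  have hsum := summable_fermi_expansion hn ha
  have hcol : ∀ j : ℕ, ((((j : ℝ) + 1) - 1 / 2 : ℝ) : ℂ) ^ (n - 1) /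
        (((Real.exp (a * (((j : ℝ) + 1) - 1 / 2)) : ℝ) : ℂ) + 1) =
      ∑' l : ℕ, (-1 : ℂ) ^ l * ((((j : ℝ) + 1 / 2 : ℝ) : ℂ) ^ (n - 1) *
        Complex.exp (-(((a * (l + 1) : ℝ) : ℂ) * ((j : ℝ) + 1 / 2 : ℝ)))) := fun j => by
    have hw : 0 < ((a * ((j : ℝ) + 1 / 2) : ℝ) : ℂ).re := by
      rw [Complex.ofReal_re]; positivity
    rw [show (j : ℝ) + 1 - 1 / 2 = j + 1 / 2 by ring, Complex.ofReal_exp, div_eq_mul_one_div,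
      ← (hasSum_fermi hw).tsum_eq, ← tsum_mul_left]
    refine tsum_congr fun l => ?_
    rw [mul_left_comm]
    congr 4
    push_cast
    ring
  have hrow : ∀ l : ℕ, ∑' j : ℕ, (-1 : ℂ) ^ l * ((((j : ℝ) + 1 / 2 : ℝ) : ℂ) ^ (n - 1) *
        Complex.exp (-(((a * (l + 1) : ℝ) : ℂ) * ((j : ℝ) + 1 / 2 : ℝ)))) =
      Complex.Gamma n * ((1 / (a : ℂ)) ^ n * ((-1) ^ l * (1 / ((l : ℂ) + 1)) ^ n)
        - ∑' k : ℕ, altLatticeTerm n a (2 * π) (l, k)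
        - ∑' k : ℕ, altLatticeTerm n a (-(2 * π)) (l, k)) := fun l => by
    have hmul : (1 / ((a * (l + 1) : ℝ) : ℂ)) ^ n =
        (1 / (a : ℂ)) ^ n * (1 / ((l : ℂ) + 1)) ^ n := by
      have h := Complex.mul_cpow_ofReal_nonneg (a := 1 / a) (b := 1 / ((l : ℝ) + 1))
        (by positivity) (by positivity) n
      push_cast at h
      rw [← h]
      push_cast
      rw [one_div_mul_one_div]
    rw [tsum_mul_left, lipschitz_summation hn (by positivity), hmul]
    simp only [altLatticeTerm, Complex.ofReal_mul, Complex.ofReal_add, Complex.ofReal_natCast,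
      Complex.ofReal_one, mul_assoc, tsum_mul_left]
    ring
  have hA : ∀ b : ℝ, b ≠ 0 → Summable fun p => altLatticeTerm n a b p := fun b hb =>
    (summable_norm_altLatticeTerm hn ha.ne' hb).of_norm
  have h1 := hA _ Real.two_pi_pos.ne'
  have h2 := hA _ (neg_ne_zero.2 Real.two_pi_pos.ne')
  have hη := (summable_alternating_one_div_cpow (n := n) (by linarith)).mul_left ((1 / (a : ℂ)) ^ n)
  have hsplit := ((hη.hasSum.sub h1.prod.hasSum).sub h2.prod.hasSum).tsum_eq
  rw [tsum_congr hcol, Summable.tsum_comm (f := fun l j : ℕ => (-1 : ℂ) ^ l *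
      ((((j : ℝ) + 1 / 2 : ℝ) : ℂ) ^ (n - 1) *
        Complex.exp (-(((a * (l + 1) : ℝ) : ℂ) * ((j : ℝ) + 1 / 2 : ℝ))))) hsum,
    tsum_congr hrow, tsum_mul_left, hsplit,
    ← h1.tsum_prod, ← h2.tsum_prod, tsum_mul_left, tsum_alternating_one_div_cpow (by linarith),
    altLatticeSum, altLatticeSum]

theorem one_div_ofReal_cpow {x : ℝ} (hx : 0 < x) (n : ℂ) :
    (1 / (x : ℂ)) ^ n = 1 / (x : ℂ) ^ n := by
  rw [one_div, one_div, Complex.inv_cpow _ _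
    (by rw [Complex.arg_ofReal_of_nonneg hx.le]; exact Real.pi_pos.ne)]

theorem sq_cpow_half {r : ℝ} (hr : 0 < r) (n : ℂ) : ((r ^ 2 : ℝ) : ℂ) ^ (n / 2) = (r : ℂ) ^ n := by
  rw [sq, Complex.ofReal_mul, Complex.mul_cpow_ofReal_nonneg hr.le hr.le,
    ← Complex.cpow_add _ _ (by exact_mod_cast hr.ne'), add_halves]

theorem cos_pi_mul_div_two (n : ℂ) :
    Complex.cos (π * n / 2) = (Complex.I ^ n + (-Complex.I) ^ n) / 2 := by
  rw [Complex.cpow_def_of_ne_zero Complex.I_ne_zero,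
    Complex.cpow_def_of_ne_zero (neg_ne_zero.2 Complex.I_ne_zero), Complex.log_I,
    Complex.log_neg_I, Complex.cos]
  ring_nf

theorem sin_pi_mul_div_two (n : ℂ) :
    Complex.sin (π * n / 2) = ((-Complex.I) ^ n - Complex.I ^ n) * Complex.I / 2 := by
  rw [Complex.cpow_def_of_ne_zero Complex.I_ne_zero,
    Complex.cpow_def_of_ne_zero (neg_ne_zero.2 Complex.I_ne_zero), Complex.log_I,
    Complex.log_neg_I, Complex.sin]
  ring_nf

theorem tendsto_principalValue {n : ℂ} (hn : 2 < n.re) {β : ℝ} (hβ : 0 < β) :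
    Tendsto (fun ε : ℝ =>
        ∫ z in {z : ℝ | 0 < z ∧ ∀ m : ℕ, 1 ≤ m → ε ≤ |z - (2 * (m : ℝ) - 1) * π / β|},
          ((z : ℂ) ^ (n - 1) / (((Real.exp (2 * π * z) : ℝ) : ℂ) + 1)) *
            ((Real.tan (β * z / 2) : ℝ) : ℂ))
      (𝓝[>] (0:ℝ)) (𝓝 (Complex.I * Complex.Gamma n *
        (altLatticeSum n (2 * π) β - altLatticeSum n (2 * π) (-β)))) := by
  obtain ⟨S, hreg, htrunc⟩ := exists_tendsto_regularized_and_truncated hn hβ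
  rw [← tendsto_nhds_unique hreg (tendsto_integral_regularizedTan hn hβ)]
  refine htrunc.congr' ?_
  filter_upwards [Ioo_mem_nhdsGT (div_pos Real.pi_pos hβ)] with ε hε
  exact (setIntegral_truncated_eq n hβ hε.2.le).symm

/-- **Corollary 9.3**: the half-integer analogue of Ramanujan's transformation formula
for generalized Eisenstein series.  The principal value integral is the limit, as
`ε → 0⁺`, of the integral over `(0, ∞)` with `ε`-neighbourhoods of the poles
`(2m - 1)π/β`, `m ≥ 1`, of `tan(βz/2)` removed. -/
theorem half_integer_eisenstein_transformation
    (α β : ℝ) (hα : 0 < α) (hβ : 0 < β) (hαβ : α * β = 4 * π^2)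
    (n : ℂ) (hn : 2 < n.re) :
    ∃ PV : ℂ,
      Tendsto (fun ε : ℝ =>
        ∫ z in {z : ℝ | 0 < z ∧ ∀ m : ℕ, 1 ≤ m → ε ≤ |z - (2 * (m : ℝ) - 1) * π / β|},
          ((z : ℂ) ^ (n - 1) / (((Real.exp (2 * π * z) : ℝ) : ℂ) + 1)) *
            ((Real.tan (β * z / 2) : ℝ) : ℂ))
        (𝓝[>] (0:ℝ)) (𝓝 PV) ∧
      (∑' j : ℕ, ((((j : ℝ) + 1) - 1/2 : ℝ) : ℂ) ^ (n - 1) /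
            (((Real.exp (β * (((j : ℝ) + 1) - 1/2)) : ℝ) : ℂ) + 1))
        + Complex.Gamma n * ((2 : ℂ) ^ ((1 : ℂ) - n) - 1) * riemannZeta n / (β : ℂ) ^ n =
      Complex.cos ((π : ℂ) * n / 2) *
          (((α / β : ℝ) : ℂ) ^ (n / 2) *
              (∑' j : ℕ, ((((j : ℝ) + 1) - 1/2 : ℝ) : ℂ) ^ (n - 1) /
                (((Real.exp (α * (((j : ℝ) + 1) - 1/2)) : ℝ) : ℂ) + 1))
            + Complex.Gamma n * ((2 : ℂ) ^ ((1 : ℂ) - n) - 1) * riemannZeta n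
                / (2 * (π : ℂ)) ^ n)
        - Complex.sin ((π : ℂ) * n / 2) * PV := by
  have h2π := Real.two_pi_pos
  have hI : |Complex.I.arg| ≤ π / 2 := by
    rw [Complex.arg_I, abs_of_pos (by positivity)]
  have hnegI : |(-Complex.I).arg| ≤ π / 2 := by
    rw [Complex.arg_neg_I, abs_neg, abs_of_pos (by positivity)]
  have hβpos : (-Complex.I) ^ n * altLatticeSum n (2 * π) (-β) = altLatticeSum n β (2 * π) := by
    refine altLatticeSum_swap_of_mul (neg_ne_zero.2 Complex.I_ne_zero) hnegI h2π ?_ ?_ <;> push_cast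
    · linear_combination (2 * π : ℂ) * Complex.I_mul_I
    · ring
  have hβneg : Complex.I ^ n * altLatticeSum n (2 * π) β = altLatticeSum n β (-(2 * π)) := by
    refine altLatticeSum_swap_of_mul Complex.I_ne_zero hI h2π ?_ ?_ <;> push_cast
    · linear_combination (2 * π : ℂ) * Complex.I_mul_I
    · ring
  have hr : 0 < α / (2 * π) := by positivity
  have hrβ : α / (2 * π) * β = 2 * π := by
    field_simp
    linarith
  have hαpos : ((α / (2 * π) : ℝ) : ℂ) ^ n * altLatticeSum n α (2 * π) =
      altLatticeSum n (2 * π) β :=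
    mul_altLatticeSum_of_pos n hα hr (div_mul_cancel₀ _ h2π.ne') hrβ
  have hαneg : ((α / (2 * π) : ℝ) : ℂ) ^ n * altLatticeSum n α (-(2 * π)) =
      altLatticeSum n (2 * π) (-β) :=
    mul_altLatticeSum_of_pos n hα hr (div_mul_cancel₀ _ h2π.ne') (by linarith)
  have hαβ' : α / β = (α / (2 * π)) ^ 2 := by
    field_simp
    linarith
  have hscale : ((α / (2 * π) : ℝ) : ℂ) ^ n * (1 / (α : ℂ)) ^ n = 1 / (2 * (π : ℂ)) ^ n := by
    have h := Complex.mul_cpow_ofReal_nonneg hr.le (one_div_pos.2 hα).le n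
    rw [← Complex.ofReal_mul, show α / (2 * π) * (1 / α) = 1 / (2 * π) by field_simp] at h
    have h' := one_div_ofReal_cpow h2π n
    push_cast at h h' ⊢
    rw [← h, h']
  refine ⟨_, tendsto_principalValue hn hβ, ?_⟩
  rw [tsum_fermi_eq hn hβ, tsum_fermi_eq hn hα, ← hβpos, ← hβneg, hαβ', sq_cpow_half hr,
    cos_pi_mul_div_two, sin_pi_mul_div_two, one_div_ofReal_cpow hβ,
    ← hαpos, ← hαneg]
  linear_combination (-(Complex.I ^ n + (-Complex.I) ^ n) / 2 * Complex.Gamma n *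
      ((1 - 2 ^ (1 - n)) * riemannZeta n)) * hscale +
    (((-Complex.I) ^ n - Complex.I ^ n) / 2 * Complex.Gamma n * ((α / (2 * π) : ℝ) : ℂ) ^ n *
      (altLatticeSum n α (2 * π) - altLatticeSum n α (-(2 * π)))) * Complex.I_mul_I
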